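/- Let η be any ball configuration and define p^σ_k(x) := x − 2·∑_{ℓ=1}^{k} ∑_{y=1}^{x} η^σ_ℓ(y) for σ ∈ {↑,↓}. (1) If η↑_k(x) = 1, then p↑_k(x) = ξ_k(x) − k; for any x' ≥ x, p↑_k(x) ≤ p↑_k(x'); and p↑_k(x) = p↑_k(x') holds if and only if ∑_{y=x+1}^{x'} ∑_{ℓ ≥ k+1} (η↑_ℓ(y) + η↓_ℓ(y)) + ∑_{y=x+1}^{x'} r(y) = 0 and ∑_{ℓ=1}^{k} 𝒲_ℓ(x') = k. (2) If η↓_k(x) = 1, then p↓_k(x) = ξ_k(x); for any x' ≥ x, p↓_k(x) ≤ p↓_k(x'); and p↓_k(x) = p↓_k(x') holds if and only if ∑_{y=x+1}^{x'} ∑_{ℓ ≥ k+1} (η↑_ℓ(y) + η↓_ℓ(y)) + ∑_{y=x+1}^{x'} r(y) = 0 and ∑_{ℓ=1}^{k} 𝒲_ℓ(x') = 0. -/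

import Mathlib

open Finset

namespace BBS

attribute [local instance] Classical.propDecidable

noncomputable section

/-- A ball configuration: `η x ∈ {0,1}`; the sites are `x = 1, 2, ...` and
the index `0` is never used. -/
def IsConf (η : ℕ → ℤ) : Prop := ∀ x, η x = 0 ∨ η x = 1

/-- The carrier with seat numbers: `W η x k = 𝒲_k(x)` (seats `k = 1, 2, ...`). -/
def W (η : ℕ → ℤ) : ℕ → ℕ → ℤ
  | 0 => fun _ => 0
  | x + 1 => fun k =>
      W η x k
        + η (x + 1) * (1 - W η x k) * ∏ ℓ ∈ Finset.Icc 1 (k - 1), W η x ℓ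
        - (1 - η (x + 1)) * W η x k * ∏ ℓ ∈ Finset.Icc 1 (k - 1), (1 - W η x ℓ)

/-- The seat number configuration `η↑_k(x)`. -/
def up (η : ℕ → ℤ) (k x : ℕ) : ℤ :=
  η x * (1 - W η (x - 1) k) * ∏ ℓ ∈ Finset.Icc 1 (k - 1), W η (x - 1) ℓ

/-- The seat number configuration `η↓_k(x)`. -/
def down (η : ℕ → ℤ) (k x : ℕ) : ℤ :=
  (1 - η x) * W η (x - 1) k * ∏ ℓ ∈ Finset.Icc 1 (k - 1), (1 - W η (x - 1) ℓ)

/-- The record indicator `r(x) = 1 - ∑_{k ∈ ℕ} (η↑_k(x) + η↓_k(x))`. -/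
def rcd (η : ℕ → ℤ) (x : ℕ) : ℤ :=
  1 - ∑' k : ℕ, if 1 ≤ k then up η k x + down η k x else 0

/-- `m^σ_k(x) = ∑_{y=1}^x (η^σ_k(y) - η^σ_{k+1}(y))`, generic in the seat family `e`. -/
def mSeq (e : ℕ → ℕ → ℤ) (k x : ℕ) : ℤ :=
  ∑ y ∈ Finset.Icc 1 x, (e k y - e (k + 1) y)

/-- `m↑_k(x)` -/
def mUp (η : ℕ → ℤ) : ℕ → ℕ → ℤ := mSeq (up η)

/-- `m↓_k(x)` -/
def mDown (η : ℕ → ℤ) : ℕ → ℕ → ℤ := mSeq (down η)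

/-- `ξ_k(x) = x - ∑_{ℓ=1}^k ∑_{y=1}^x (η↑_ℓ(y) + η↓_ℓ(y))`. -/
def xi (η : ℕ → ℤ) (k x : ℕ) : ℤ :=
  (x : ℤ) - ∑ ℓ ∈ Finset.Icc 1 k, ∑ y ∈ Finset.Icc 1 x, (up η ℓ y + down η ℓ y)

/-- `{x : m↑_k(x) ≥ j ∧ m↓_k(x) ≥ j}`; `τ_k(j) < ∞` iff this set is nonempty. -/
def tauSet (η : ℕ → ℤ) (k j : ℕ) : Set ℕ :=
  {x : ℕ | (j : ℤ) ≤ mUp η k x ∧ (j : ℤ) ≤ mDown η k x}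

/-- `τ_k(j)` (with junk value `0` when `τ_k(j) = ∞`). -/
def tau (η : ℕ → ℤ) (k j : ℕ) : ℕ := sInf (tauSet η k j)

/-- `ζ_k(i)`, the number of `j` with `τ_k(j) < ∞` at effective position `ξ_k(τ_k(j)) = i`. -/
def zeta (η : ℕ → ℤ) (k : ℕ) (i : ℤ) : ℕ :=
  Set.ncard {j : ℕ | 1 ≤ j ∧ (tauSet η k j).Nonempty ∧ xi η k (tau η k j) = i}

/-- `{x : ξ_k(x) = i}`; `s_k(i) < ∞` iff this set is nonempty. -/
def sSet (η : ℕ → ℤ) (k : ℕ) (i : ℤ) : Set ℕ := {x : ℕ | xi η k x = i}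

/-- `s_k(i)` (with junk value `0` when `s_k(i) = ∞`). -/
def sPos (η : ℕ → ℤ) (k : ℕ) (i : ℤ) : ℕ := sInf (sSet η k i)

/-- The carrier with infinite capacity: `carrier η x = W_∞(x)`. -/
def carrier (η : ℕ → ℤ) : ℕ → ℤ
  | 0 => 0
  | x + 1 => carrier η x + η (x + 1) - min (1 - η (x + 1)) (carrier η x)

/-- The BBS time evolution `T`. -/
def Tev (η : ℕ → ℤ) (x : ℕ) : ℤ := η x + carrier η (x - 1) - carrier η x

/-- The carrier with capacity `c ∈ ℕ ∪ {∞}`. -/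
def carrierC (c : ℕ∞) (η : ℕ → ℤ) : ℕ → ℤ
  | 0 => 0
  | x + 1 =>
      carrierC c η x
        + (if c = ⊤ then η (x + 1)
            else min (η (x + 1)) (((c.toNat : ℕ) : ℤ) - carrierC c η x))
        - min (1 - η (x + 1)) (carrierC c η x)

/-- The BBS time evolution `T_ℓ` with carrier capacity `ℓ = c`. -/
def TevC (c : ℕ∞) (η : ℕ → ℤ) (x : ℕ) : ℤ :=
  η x + carrierC c η (x - 1) - carrierC c η x

/-- `p^σ_k(x) = x - 2 ∑_{ℓ=1}^k ∑_{y=1}^x η^σ_ℓ(y)`, generic in the seat family `e`. -/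
def pSeat (e : ℕ → ℕ → ℤ) (k x : ℕ) : ℤ :=
  (x : ℤ) - 2 * ∑ ℓ ∈ Finset.Icc 1 k, ∑ y ∈ Finset.Icc 1 x, e ℓ y

/-- `t^σ_k(x,j) = max{1 ≤ y ≤ x : m^σ_k(y) = j, η^σ_k(y) = 1}`. -/
def tmax (e : ℕ → ℕ → ℤ) (k x : ℕ) (j : ℤ) : ℕ :=
  sSup {y : ℕ | 1 ≤ y ∧ y ≤ x ∧ mSeq e k y = j ∧ e k y = 1}

/-- The largest entry of a multiset of integers (junk for the empty multiset). -/
def maxE (s : Multiset ℤ) : ℤ := sSup {a : ℤ | a ∈ s}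

/-- The refined rigging algorithm: `rigSeq e x k` is the multiset of entries of the
array `J^σ_k(x)`, where `e = η^σ`. -/
def rigSeq (e : ℕ → ℕ → ℤ) : ℕ → ℕ → Multiset ℤ
  | 0 => fun _ => 0
  | x + 1 =>
      let J := rigSeq e x
      let k1 := sSup {k : ℕ | 1 ≤ k ∧ e k (x + 1) = 1}
      if k1 = 0 then J
      else fun j =>
        if j = k1 then pSeat e k1 (x + 1) ::ₘ J j
        else if 1 ≤ j ∧ j + 1 = k1 then (J j).erase (maxE (J j))
        else J j

/-- The KKR algorithm: `kkr η x k` is the multiset of rigging entries attached to the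
rows of length `k` of the rigged partition `(μ(x), J(x))`. -/
def kkr (η : ℕ → ℤ) : ℕ → ℕ → Multiset ℤ
  | 0 => fun _ => 0
  | x + 1 =>
      let R := kkr η x
      if η (x + 1) = 1 then
        -- the vacancy `p_k(x)` of the current rigged partition
        let p : ℕ → ℤ := fun k =>
          (x : ℤ) - 2 * ∑' j : ℕ, ((R j).card : ℤ) * min (j : ℤ) (k : ℤ)
        -- the maximal length of a singular row (`0` if there is none)
        let k0 : ℕ := sSup {k : ℕ | 1 ≤ k ∧ p k ∈ R k ∧ ∀ a ∈ R k, a ≤ p k}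
        -- the multiplicities of the new partition `μ(x+1)`
        let m' : ℕ → ℤ := fun j =>
          ((R j).card : ℤ) + (if j = k0 + 1 then 1 else 0) - (if 1 ≤ j ∧ j = k0 then 1 else 0)
        -- the vacancy `p_{k0+1}(x+1)` of the new rigged partition
        let p' : ℤ := ((x : ℤ) + 1) - 2 * ∑' j : ℕ, m' j * min (j : ℤ) ((k0 : ℤ) + 1)
        fun k =>
          if k = k0 + 1 then p' ::ₘ R k
          else if k = k0 then (R k).erase (p k0)
          else R k
      else R

/-- The conjugate partition `λ_k(x)` of `μ(x)` in the KKR algorithm. -/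
def lamKKR (η : ℕ → ℤ) (k x : ℕ) : ℤ :=
  ∑' j : ℕ, if k ≤ j then ((kkr η x j).card : ℤ) else 0

/-- The vacancy `p_k(x) = x - 2 ∑_i min{μ_i(x), k}` in the KKR algorithm. -/
def pKKR (η : ℕ → ℤ) (k x : ℕ) : ℤ :=
  (x : ℤ) - 2 * ∑' j : ℕ, ((kkr η x j).card : ℤ) * min (j : ℤ) (k : ℤ)

/-! Interlacing Young diagrams.  A Young diagram is encoded as the multiset of its
(positive) row lengths. -/

/-- The conjugate partition: `conj μ k = λ_k`, the number of rows of length `≥ k`. -/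
def conj (μ : Multiset ℕ) (k : ℕ) : ℕ := (μ.filter (fun r => k ≤ r)).card

/-- `(μ↑, μ↓)` is interlacing: `μ↑_1 ≥ μ↓_1 ≥ μ↑_2 ≥ μ↓_2 ≥ ⋯`, equivalently
`λ↑_k − λ↓_k ∈ {0,1}` for all `k ≥ 1`. -/
def Interlacing (a b : Multiset ℕ) : Prop :=
  ∀ k, 1 ≤ k → conj b k ≤ conj a k ∧ conj a k ≤ conj b k + 1

/-- `{k ≥ 1 : λ↑_ℓ − λ↓_ℓ = 1 for all 1 ≤ ℓ ≤ k}`. -/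
def kUpSet (a b : Multiset ℕ) : Set ℕ :=
  {k : ℕ | 1 ≤ k ∧ ∀ ℓ, 1 ≤ ℓ → ℓ ≤ k → conj a ℓ = conj b ℓ + 1}

/-- `{k ≥ 1 : λ↑_ℓ − λ↓_ℓ = 0 for all 1 ≤ ℓ ≤ k}`. -/
def kDownSet (a b : Multiset ℕ) : Set ℕ :=
  {k : ℕ | 1 ≤ k ∧ ∀ ℓ, 1 ≤ ℓ → ℓ ≤ k → conj a ℓ = conj b ℓ}

/-- `k↑` (with `sup ∅ = 0`). -/
def kUp (a b : Multiset ℕ) : ℕ := sSup (kUpSet a b)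

/-- `k↓` (with `sup ∅ = 0`; junk value `0` also when `k↓ = ∞`, i.e. `μ↑ = μ↓`). -/
def kDown (a b : Multiset ℕ) : ℕ := sSup (kDownSet a b)

/-- Add one box to a row of length `k` (a new row of length `1` is added if `k = 0`). -/
def addBox (μ : Multiset ℕ) (k : ℕ) : Multiset ℕ := (k + 1) ::ₘ μ.erase k

/-- The interlacing-diagrams algorithm producing `(μ↑(x), μ↓(x))`. -/
def ydPair (η : ℕ → ℤ) : ℕ → Multiset ℕ × Multiset ℕ
  | 0 => (0, 0)
  | x + 1 =>
      let P := ydPair η x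
      if η (x + 1) = 1 then (addBox P.1 (kUp P.1 P.2), P.2)
      else if P.1 ≠ P.2 then (P.1, addBox P.2 (kDown P.1 P.2))
      else P

/-! The Takahashi–Satsuma algorithm and the slot configuration.  The state of the
algorithm is the set `C` of crossed-out sites. -/

/-- The sites not yet crossed out. -/
def active (C : Set ℕ) : Set ℕ := {x | 1 ≤ x ∧ x ∉ C}

/-- The maximal run (of consecutive equal letters among uncrossed sites) containing `x`. -/
def runOf (η : ℕ → ℤ) (C : Set ℕ) (x : ℕ) : Set ℕ :=
  {y | x ∈ active C ∧ y ∈ active C ∧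
    ∀ z ∈ active C, min x y ≤ z → z ≤ max x y → η z = η x}

/-- The length of the run containing `x`, in `ℕ∞`. -/
def runLen (η : ℕ → ℤ) (C : Set ℕ) (x : ℕ) : ℕ∞ :=
  if (runOf η C x).Infinite then ⊤ else ((runOf η C x).ncard : ℕ∞)

/-- The first sites of runs qualifying for the TS step: the run has a preceding run and
is at least as long as it. -/
def qualSet (η : ℕ → ℤ) (C : Set ℕ) : Set ℕ :=
  {b | b ∈ active C ∧ sInf (runOf η C b) = b ∧
    {y ∈ active C | y < b}.Nonempty ∧
    runLen η C (sSup {y ∈ active C | y < b}) ≤ runLen η C b}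

/-- The first site of the leftmost qualifying run. -/
def bSel (η : ℕ → ℤ) (C : Set ℕ) : ℕ := sInf (qualSet η C)

/-- The last site of the run preceding the selected run. -/
def prevSel (η : ℕ → ℤ) (C : Set ℕ) : ℕ :=
  sSup {y ∈ active C | y < bSel η C}

/-- The last `k` letters of the preceding run (the whole preceding run, whose length is `k`). -/
def S1 (η : ℕ → ℤ) (C : Set ℕ) : Set ℕ := runOf η C (prevSel η C)

/-- The first `k` letters of the selected run. -/
def S2 (η : ℕ → ℤ) (C : Set ℕ) : Set ℕ :=
  {y ∈ runOf η C (bSel η C) |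
    ({z ∈ runOf η C (bSel η C) | z ≤ y}).ncard ≤ (S1 η C).ncard}

/-- One step of the TS algorithm: cross out the identified soliton (if any run qualifies). -/
def tsStep (η : ℕ → ℤ) (C : Set ℕ) : Set ℕ :=
  if (qualSet η C).Nonempty then C ∪ S1 η C ∪ S2 η C else C

/-- The crossed-out sites after `n` steps of the TS algorithm. -/
def tsC (η : ℕ → ℤ) : ℕ → Set ℕ
  | 0 => ∅
  | n + 1 => tsStep η (tsC η n)

/-- The slot configuration `ν : ℕ → ℤ_{≥0} ∪ {∞}`: for a `k`-soliton
`γ = {z_1 < ⋯ < z_{2k}}`, `ν(z_l) = ν(z_{l+k}) = l − 1`, and `ν(x) = ∞` for records. -/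
def nuTS (η : ℕ → ℤ) (z : ℕ) : ℕ∞ :=
  if _h : ∃ n, z ∈ tsC η (n + 1) ∧ z ∉ tsC η n then
    let n := sInf {n : ℕ | z ∈ tsC η (n + 1) ∧ z ∉ tsC η n}
    if z ∈ S1 η (tsC η n) then (({w ∈ S1 η (tsC η n) | w < z}).ncard : ℕ∞)
    else (({w ∈ S2 η (tsC η n) | w < z}).ncard : ℕ∞)
  else ⊤

/-- `ξ̃_k(x)`, the number of `k`-slots in `[1,x]`. -/
def xiTS (η : ℕ → ℤ) (k x : ℕ) : ℕ :=
  Set.ncard {y : ℕ | 1 ≤ y ∧ y ≤ x ∧ (k : ℕ∞) ≤ nuTS η y}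

/-- `s̃_k(i)`, the position of the `i`-th `k`-slot. -/
def sTS (η : ℕ → ℤ) (k i : ℕ) : ℕ := sInf {x : ℕ | xiTS η k x = i}

/-- The slot decomposition `ζ̃_k(i)`: the number of `k`-solitons appended to the
`i`-th `k`-slot. -/
def zetaTS (η : ℕ → ℤ) (k i : ℕ) : ℕ :=
  Set.ncard {n : ℕ | (qualSet η (tsC η n)).Nonempty ∧ (S1 η (tsC η n)).ncard = k ∧
    ∀ z ∈ S1 η (tsC η n) ∪ S2 η (tsC η n), sTS η k i ≤ z ∧ z ≤ sTS η k (i + 1) - 1}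

end

end BBS

namespace BBS

theorem W_succ (η : ℕ → ℤ) (x k : ℕ) :
    W η (x + 1) k = W η x k + up η k (x + 1) - down η k (x + 1) := rfl

theorem W_zero_or_one {η : ℕ → ℤ} (hη : IsConf η) (x k : ℕ) : W η x k = 0 ∨ W η x k = 1 := by
  induction x generalizing k with
  | zero => exact Or.inl rfl
  | succ x ih =>
    have hP : ∀ s : Finset ℕ, ∏ ℓ ∈ s, W η x ℓ = 0 ∨ ∏ ℓ ∈ s, W η x ℓ = 1 := fun s => by
      refine Finset.prod_induction _ (fun a => a = 0 ∨ a = 1) ?_ (Or.inr rfl) fun ℓ _ => ih ℓ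
      rintro a b (rfl | rfl) (rfl | rfl) <;> simp
    have hQ : ∀ s : Finset ℕ, ∏ ℓ ∈ s, (1 - W η x ℓ) = 0 ∨ ∏ ℓ ∈ s, (1 - W η x ℓ) = 1 :=
      fun s => by
      refine Finset.prod_induction _ (fun a => a = 0 ∨ a = 1) ?_ (Or.inr rfl) fun ℓ _ => ?_
      · rintro a b (rfl | rfl) (rfl | rfl) <;> simp
      · rcases ih ℓ with h | h <;> simp [h]
    simp only [W]
    rcases hη (x + 1) with h | h <;> rcases ih k with h' | h' <;>
      rcases hP (Finset.Icc 1 (k - 1)) with h1 | h1 <;>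
      rcases hQ (Finset.Icc 1 (k - 1)) with h2 | h2 <;> simp [h, h', h1, h2]

theorem W_eq_zero_of_lt (η : ℕ → ℤ) {x k : ℕ} (h : x < k) : W η x k = 0 := by
  induction x generalizing k with
  | zero => rfl
  | succ x ih =>
    have hP : ∏ ℓ ∈ Finset.Icc 1 (k - 1), W η x ℓ = 0 :=
      Finset.prod_eq_zero (i := x + 1) (by simp; omega) (ih (by omega))
    simp [W, ih (show x < k by omega), hP]

theorem up_add_down_eq_zero_of_lt (η : ℕ → ℤ) {x k : ℕ} (hx : 1 ≤ x) (h : x < k) :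
    up η k x + down η k x = 0 := by
  have hP : ∏ ℓ ∈ Finset.Icc 1 (k - 1), W η (x - 1) ℓ = 0 :=
    Finset.prod_eq_zero (i := x) (by simp; omega) (W_eq_zero_of_lt η (by omega))
  simp [up, down, hP, W_eq_zero_of_lt η (show x - 1 < k by omega)]

theorem sum_up_Icc (η : ℕ → ℤ) (k x : ℕ) :
    ∑ ℓ ∈ Finset.Icc 1 k, up η ℓ x = η x * (1 - ∏ ℓ ∈ Finset.Icc 1 k, W η (x - 1) ℓ) := by
  induction k with
  | zero => simp
  | succ k ih =>
    rw [Finset.sum_Icc_succ_top (by omega), Finset.prod_Icc_succ_top (by omega), ih]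
    simp only [up, Nat.add_sub_cancel]
    ring

theorem sum_down_Icc (η : ℕ → ℤ) (k x : ℕ) :
    ∑ ℓ ∈ Finset.Icc 1 k, down η ℓ x =
      (1 - η x) * (1 - ∏ ℓ ∈ Finset.Icc 1 k, (1 - W η (x - 1) ℓ)) := by
  induction k with
  | zero => simp
  | succ k ih =>
    rw [Finset.sum_Icc_succ_top (by omega), Finset.prod_Icc_succ_top (by omega), ih]
    simp only [down, Nat.add_sub_cancel]
    ring

theorem sum_up_add_down_le_one {η : ℕ → ℤ} (hη : IsConf η) (k x : ℕ) :
    ∑ ℓ ∈ Finset.Icc 1 k, (up η ℓ x + down η ℓ x) ≤ 1 := by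
  have hP : 0 ≤ ∏ ℓ ∈ Finset.Icc 1 k, W η (x - 1) ℓ :=
    Finset.prod_nonneg fun ℓ _ => by rcases W_zero_or_one hη (x - 1) ℓ with h | h <;> simp [h]
  have hQ : 0 ≤ ∏ ℓ ∈ Finset.Icc 1 k, (1 - W η (x - 1) ℓ) :=
    Finset.prod_nonneg fun ℓ _ => by rcases W_zero_or_one hη (x - 1) ℓ with h | h <;> simp [h]
  rw [Finset.sum_add_distrib, sum_up_Icc, sum_down_Icc]
  rcases hη x with h | h <;> rw [h] <;> linarith

theorem tsum_seats_add_rcd (η : ℕ → ℤ) (k : ℕ) {y : ℕ} (hy : 1 ≤ y) :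
    (∑' ℓ : ℕ, if k + 1 ≤ ℓ then up η ℓ y + down η ℓ y else 0) + rcd η y =
      1 - ∑ ℓ ∈ Finset.Icc 1 k, (up η ℓ y + down η ℓ y) := by
  have hfin : ∀ j : ℕ, (∑' ℓ : ℕ, if j ≤ ℓ then up η ℓ y + down η ℓ y else 0) =
      ∑ ℓ ∈ Finset.Icc j (k + y), (up η ℓ y + down η ℓ y) := fun j => by
    rw [tsum_eq_sum (s := Finset.Icc j (k + y))]
    · exact Finset.sum_congr rfl fun ℓ hℓ => if_pos (Finset.mem_Icc.1 hℓ).1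
    · intro ℓ hℓ
      split_ifs with h
      · rw [Finset.mem_Icc] at hℓ
        exact up_add_down_eq_zero_of_lt η hy (by omega)
      · rfl
  have hdisj : Disjoint (Finset.Icc 1 k) (Finset.Icc (k + 1) (k + y)) :=
    Finset.disjoint_left.2 fun a ha hb => by
      rw [Finset.mem_Icc] at ha hb
      omega
  have hunion : Finset.Icc 1 (k + y) = Finset.Icc 1 k ∪ Finset.Icc (k + 1) (k + y) := by
    ext a
    simp only [Finset.mem_union, Finset.mem_Icc]
    omega
  rw [rcd, hfin, hfin, hunion, Finset.sum_union hdisj]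
  ring

theorem sum_up_sub_sum_down (η : ℕ → ℤ) (k x : ℕ) :
    ∑ y ∈ Finset.Icc 1 x, up η k y - ∑ y ∈ Finset.Icc 1 x, down η k y = W η x k := by
  induction x with
  | zero => simp [W]
  | succ x ih =>
    rw [Finset.sum_Icc_succ_top (by omega), Finset.sum_Icc_succ_top (by omega), W_succ, ← ih]
    ring

theorem pSeat_up_eq (η : ℕ → ℤ) (k x : ℕ) :
    pSeat (up η) k x = xi η k x - ∑ ℓ ∈ Finset.Icc 1 k, W η x ℓ := by
  simp only [pSeat, xi, ← sum_up_sub_sum_down, Finset.sum_sub_distrib, Finset.sum_add_distrib]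
  ring

theorem pSeat_down_eq (η : ℕ → ℤ) (k x : ℕ) :
    pSeat (down η) k x = xi η k x + ∑ ℓ ∈ Finset.Icc 1 k, W η x ℓ := by
  simp only [pSeat, xi, ← sum_up_sub_sum_down, Finset.sum_sub_distrib, Finset.sum_add_distrib]
  ring

theorem xi_succ (η : ℕ → ℤ) (k x : ℕ) :
    xi η k (x + 1) =
      xi η k x + (1 - ∑ ℓ ∈ Finset.Icc 1 k, (up η ℓ (x + 1) + down η ℓ (x + 1))) := by
  have h : ∀ ℓ, ∑ y ∈ Finset.Icc 1 (x + 1), (up η ℓ y + down η ℓ y) =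
      ∑ y ∈ Finset.Icc 1 x, (up η ℓ y + down η ℓ y) + (up η ℓ (x + 1) + down η ℓ (x + 1)) :=
    fun ℓ => Finset.sum_Icc_succ_top (by omega) _
  simp only [xi, h]
  rw [Finset.sum_add_distrib]
  push_cast
  ring

theorem xi_mono {η : ℕ → ℤ} (hη : IsConf η) (k : ℕ) : Monotone (xi η k) :=
  monotone_nat_of_le_succ fun x => by
    rw [xi_succ]
    linarith [sum_up_add_down_le_one hη k (x + 1)]

theorem sum_seats_add_sum_rcd (η : ℕ → ℤ) (k : ℕ) {x x' : ℕ} (h : x ≤ x') :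
    (∑ y ∈ Finset.Icc (x + 1) x', ∑' ℓ : ℕ, if k + 1 ≤ ℓ then up η ℓ y + down η ℓ y else 0) +
      ∑ y ∈ Finset.Icc (x + 1) x', rcd η y = xi η k x' - xi η k x := by
  rw [← Finset.sum_add_distrib]
  induction x', h using Nat.le_induction with
  | base => simp
  | succ n hn ih =>
    rw [Finset.sum_Icc_succ_top (by omega), ih, tsum_seats_add_rcd η k (by omega), xi_succ]
    ring

theorem sum_W_nonneg {η : ℕ → ℤ} (hη : IsConf η) (k x : ℕ) :
    0 ≤ ∑ ℓ ∈ Finset.Icc 1 k, W η x ℓ :=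
  Finset.sum_nonneg fun ℓ _ => by rcases W_zero_or_one hη x ℓ with h | h <;> simp [h]

theorem sum_W_le {η : ℕ → ℤ} (hη : IsConf η) (k x : ℕ) :
    ∑ ℓ ∈ Finset.Icc 1 k, W η x ℓ ≤ k := by
  have h := Finset.sum_le_card_nsmul (Finset.Icc 1 k) (W η x) 1
    fun ℓ _ => by rcases W_zero_or_one hη x ℓ with h | h <;> simp [h]
  simpa using h

theorem W_eq_one_of_up {η : ℕ → ℤ} (hη : IsConf η) {k x ℓ : ℕ} (hx : 1 ≤ x)
    (h : up η k x = 1) (hℓ : ℓ ∈ Finset.Icc 1 k) : W η x ℓ = 1 := by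
  obtain ⟨x, rfl⟩ : ∃ n, x = n + 1 := ⟨x - 1, by omega⟩
  simp only [up, Nat.add_sub_cancel] at h
  rw [Finset.mem_Icc] at hℓ
  have he : η (x + 1) = 1 := (hη (x + 1)).resolve_left fun h0 => by simp [h0] at h
  have hW : W η x k = 0 := (W_zero_or_one hη x k).resolve_right fun h1 => by simp [h1] at h
  simp only [he, hW, sub_zero, one_mul] at h
  rcases hℓ.2.eq_or_lt with rfl | hlt
  · simp [W, he, hW, h]
  · have h1 : W η x ℓ = 1 := (W_zero_or_one hη x ℓ).resolve_left fun h0 => by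
      rw [Finset.prod_eq_zero (i := ℓ) (by simp; omega) h0] at h
      exact zero_ne_one h
    simp [W, he, h1]

theorem W_eq_zero_of_down {η : ℕ → ℤ} (hη : IsConf η) {k x ℓ : ℕ} (hx : 1 ≤ x)
    (h : down η k x = 1) (hℓ : ℓ ∈ Finset.Icc 1 k) : W η x ℓ = 0 := by
  obtain ⟨x, rfl⟩ : ∃ n, x = n + 1 := ⟨x - 1, by omega⟩
  simp only [down, Nat.add_sub_cancel] at h
  rw [Finset.mem_Icc] at hℓ
  have he : η (x + 1) = 0 := (hη (x + 1)).resolve_right fun h1 => by simp [h1] at h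
  have hW : W η x k = 1 := (W_zero_or_one hη x k).resolve_left fun h0 => by simp [h0] at h
  simp only [he, hW, sub_zero, one_mul] at h
  rcases hℓ.2.eq_or_lt with rfl | hlt
  · simp [W, he, hW, h]
  · have h0 : W η x ℓ = 0 := (W_zero_or_one hη x ℓ).resolve_right fun h1 => by
      rw [Finset.prod_eq_zero (i := ℓ) (by simp; omega) (by simp [h1])] at h
      exact zero_ne_one h
    simp [W, he, h0]

/-- Lemma 4.5: properties of the `k`-th `σ`-vacancy `p^σ_k`. -/
theorem statement15 (η : ℕ → ℤ) (hη : IsConf η) (k : ℕ) (hk : 1 ≤ k) (x : ℕ) (hx : 1 ≤ x) :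
    (up η k x = 1 →
      pSeat (up η) k x = xi η k x - (k : ℤ) ∧
      ∀ x', x ≤ x' →
        (pSeat (up η) k x ≤ pSeat (up η) k x' ∧
         (pSeat (up η) k x = pSeat (up η) k x' ↔
            ((∑ y ∈ Finset.Icc (x + 1) x',
                  ∑' ℓ : ℕ, if k + 1 ≤ ℓ then up η ℓ y + down η ℓ y else 0) +
                ∑ y ∈ Finset.Icc (x + 1) x', rcd η y = 0 ∧
             ∑ ℓ ∈ Finset.Icc 1 k, W η x' ℓ = (k : ℤ))))) ∧
    (down η k x = 1 →
      pSeat (down η) k x = xi η k x ∧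
      ∀ x', x ≤ x' →
        (pSeat (down η) k x ≤ pSeat (down η) k x' ∧
         (pSeat (down η) k x = pSeat (down η) k x' ↔
            ((∑ y ∈ Finset.Icc (x + 1) x',
                  ∑' ℓ : ℕ, if k + 1 ≤ ℓ then up η ℓ y + down η ℓ y else 0) +
                ∑ y ∈ Finset.Icc (x + 1) x', rcd η y = 0 ∧
             ∑ ℓ ∈ Finset.Icc 1 k, W η x' ℓ = 0)))) := by
  constructor
  · intro h
    have hW : ∑ ℓ ∈ Finset.Icc 1 k, W η x ℓ = k := by
      rw [Finset.sum_congr rfl fun ℓ hℓ => W_eq_one_of_up hη hx h hℓ]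
      simp
    refine ⟨by rw [pSeat_up_eq, hW], fun x' hx' => ?_⟩
    have hxi := xi_mono hη k hx'
    have hle := sum_W_le hη k x'
    rw [sum_seats_add_sum_rcd η k hx', pSeat_up_eq, pSeat_up_eq, hW]
    refine ⟨by linarith, fun h => ⟨by linarith, by linarith⟩, fun h => by linarith [h.1, h.2]⟩
  · intro h
    have hW : ∑ ℓ ∈ Finset.Icc 1 k, W η x ℓ = 0 :=
      Finset.sum_eq_zero fun ℓ hℓ => W_eq_zero_of_down hη hx h hℓ
    refine ⟨by rw [pSeat_down_eq, hW, add_zero], fun x' hx' => ?_⟩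
    have hxi := xi_mono hη k hx'
    have hle := sum_W_nonneg hη k x'
    rw [sum_seats_add_sum_rcd η k hx', pSeat_down_eq, pSeat_down_eq, hW]
    refine ⟨by linarith, fun h => ⟨by linarith, by linarith⟩, fun h => by linarith [h.1, h.2]⟩

end BBS
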